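/- Fix a coefficient α ≥ 1 and a number of agents n ≥ 3. Mechanism 4, which outputs (min_i x_i, max_i x_i) for the reported location profile x, is group strategyproof in the private-locations setting, 2α-approximate under the maximum cost objective, and α(n−2)-approximate under the total cost objective. -/

import Mathlib

open scoped BigOperators

noncomputable section

/-- A location profile of `n` agents on the line. -/
abbrev Loc (n : ℕ) := Fin n → ℝ

/-- A preference profile: `true` means the agent prefers facility `F₁`,
`false` means the agent prefers facility `F₂`. -/
abbrev Pref (n : ℕ) := Fin n → Bool

/-- All agent locations lie in the unit interval `[0,1]`. -/
def validLoc {n : ℕ} (x : Loc n) : Prop := ∀ i, x i ∈ Set.Icc (0:ℝ) 1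

/-- The pair of facility locations lies in `[0,1]²`. -/
def inBox (y : ℝ × ℝ) : Prop := y.1 ∈ Set.Icc (0:ℝ) 1 ∧ y.2 ∈ Set.Icc (0:ℝ) 1

/-- The location of the facility indexed by `b` (`true` = `F₁`, `false` = `F₂`). -/
def facLoc (y : ℝ × ℝ) (b : Bool) : ℝ := if b then y.1 else y.2

/-- Cost of an agent located at `xi` whose preferred facility is `σi`:
`min(|xi − y_{σi}|, α·|xi − y_{3−σi}|)`. -/
def cost (α xi : ℝ) (σi : Bool) (y : ℝ × ℝ) : ℝ :=
  min |xi - facLoc y σi| (α * |xi - facLoc y (!σi)|)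

/-- Utility of an agent located at `xi` whose preferred facility is `σi`:
`max(1 − |xi − y_{σi}|, (1 − |xi − y_{3−σi}|)/α)`. -/
def util (α xi : ℝ) (σi : Bool) (y : ℝ × ℝ) : ℝ :=
  max (1 - |xi - facLoc y σi|) ((1 - |xi - facLoc y (!σi)|) / α)

/-- Total cost. -/
def SC {n : ℕ} (α : ℝ) (x : Loc n) (σ : Pref n) (y : ℝ × ℝ) : ℝ :=
  ∑ i, cost α (x i) (σ i) y

/-- Maximum cost. -/
def BC {n : ℕ} (α : ℝ) (x : Loc n) (σ : Pref n) (y : ℝ × ℝ) : ℝ :=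
  ⨆ i, cost α (x i) (σ i) y

/-- Total utility. -/
def SU {n : ℕ} (α : ℝ) (x : Loc n) (σ : Pref n) (y : ℝ × ℝ) : ℝ :=
  ∑ i, util α (x i) (σ i) y

/-- Minimum utility. -/
def BU {n : ℕ} (α : ℝ) (x : Loc n) (σ : Pref n) (y : ℝ × ℝ) : ℝ :=
  ⨅ i, util α (x i) (σ i) y

/-- Optimal (minimal) total cost over `y ∈ [0,1]²`. -/
def optSC {n : ℕ} (α : ℝ) (x : Loc n) (σ : Pref n) : ℝ :=
  sInf {c | ∃ y, inBox y ∧ c = SC α x σ y}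

/-- Optimal (minimal) maximum cost over `y ∈ [0,1]²`. -/
def optBC {n : ℕ} (α : ℝ) (x : Loc n) (σ : Pref n) : ℝ :=
  sInf {c | ∃ y, inBox y ∧ c = BC α x σ y}

/-- Optimal (maximal) total utility over `y ∈ [0,1]²`. -/
def optSU {n : ℕ} (α : ℝ) (x : Loc n) (σ : Pref n) : ℝ :=
  sSup {c | ∃ y, inBox y ∧ c = SU α x σ y}

/-- Optimal (maximal) minimum utility over `y ∈ [0,1]²`. -/
def optBU {n : ℕ} (α : ℝ) (x : Loc n) (σ : Pref n) : ℝ :=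
  sSup {c | ∃ y, inBox y ∧ c = BU α x σ y}

/-- Strategyproofness in the private-preferences setting (cost version):
no agent can strictly decrease his cost by misreporting his preference. -/
def SPprefCost {n : ℕ} (α : ℝ) (f : Loc n → Pref n → ℝ × ℝ) : Prop :=
  ∀ x : Loc n, validLoc x → ∀ σ : Pref n, ∀ i : Fin n, ∀ b : Bool,
    cost α (x i) (σ i) (f x σ) ≤ cost α (x i) (σ i) (f x (Function.update σ i b))

/-- Strategyproofness in the private-preferences setting (utility version):
no agent can strictly increase his utility by misreporting his preference. -/
def SPprefUtil {n : ℕ} (α : ℝ) (f : Loc n → Pref n → ℝ × ℝ) : Prop :=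
  ∀ x : Loc n, validLoc x → ∀ σ : Pref n, ∀ i : Fin n, ∀ b : Bool,
    util α (x i) (σ i) (f x (Function.update σ i b)) ≤ util α (x i) (σ i) (f x σ)

/-- Group strategyproofness in the private-preferences setting (cost version):
for every joint misreport of preferences, some deviating agent does not
strictly decrease his cost. -/
def GSPprefCost {n : ℕ} (α : ℝ) (f : Loc n → Pref n → ℝ × ℝ) : Prop :=
  ∀ x : Loc n, validLoc x → ∀ σ σ' : Pref n, σ' ≠ σ →
    ∃ i : Fin n, σ' i ≠ σ i ∧
      cost α (x i) (σ i) (f x σ) ≤ cost α (x i) (σ i) (f x σ')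

/-- Group strategyproofness in the private-preferences setting (utility version). -/
def GSPprefUtil {n : ℕ} (α : ℝ) (f : Loc n → Pref n → ℝ × ℝ) : Prop :=
  ∀ x : Loc n, validLoc x → ∀ σ σ' : Pref n, σ' ≠ σ →
    ∃ i : Fin n, σ' i ≠ σ i ∧
      util α (x i) (σ i) (f x σ') ≤ util α (x i) (σ i) (f x σ)

/-- Strategyproofness in the private-locations setting (cost version). -/
def SPlocCost {n : ℕ} (α : ℝ) (f : Loc n → Pref n → ℝ × ℝ) : Prop :=
  ∀ x : Loc n, validLoc x → ∀ σ : Pref n, ∀ i : Fin n, ∀ z ∈ Set.Icc (0:ℝ) 1,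
    cost α (x i) (σ i) (f x σ) ≤ cost α (x i) (σ i) (f (Function.update x i z) σ)

/-- Strategyproofness in the private-locations setting (utility version). -/
def SPlocUtil {n : ℕ} (α : ℝ) (f : Loc n → Pref n → ℝ × ℝ) : Prop :=
  ∀ x : Loc n, validLoc x → ∀ σ : Pref n, ∀ i : Fin n, ∀ z ∈ Set.Icc (0:ℝ) 1,
    util α (x i) (σ i) (f (Function.update x i z) σ) ≤ util α (x i) (σ i) (f x σ)

/-- Group strategyproofness in the private-locations setting (cost version). -/
def GSPlocCost {n : ℕ} (α : ℝ) (f : Loc n → Pref n → ℝ × ℝ) : Prop :=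
  ∀ x : Loc n, validLoc x → ∀ σ : Pref n, ∀ x' : Loc n, validLoc x' → x' ≠ x →
    ∃ i : Fin n, x' i ≠ x i ∧
      cost α (x i) (σ i) (f x σ) ≤ cost α (x i) (σ i) (f x' σ)

/-- Anonymity: the output is invariant under simultaneous permutations of the agents. -/
def Anonymous {n : ℕ} (f : Loc n → Pref n → ℝ × ℝ) : Prop :=
  ∀ (x : Loc n) (σ : Pref n) (π : Equiv.Perm (Fin n)), f (x ∘ π) (σ ∘ π) = f x σ

/-- Mechanism 1: `F₁` at `(lt+lb)/2` and `F₂` at `(rt+rb)/2`, where `lt`,`rt` are the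
extreme agent locations, `cen` their midpoint, `lb` (`rb`) the agent location closest
to `cen` from the left (right). -/
def mech1 {n : ℕ} (x : Loc n) : ℝ × ℝ :=
  ((⨅ i, x i) / 2 + sSup {z | (∃ i, x i = z) ∧ z ≤ ((⨅ i, x i) + (⨆ i, x i)) / 2} / 2,
   (⨆ i, x i) / 2 + sInf {z | (∃ i, x i = z) ∧ ((⨅ i, x i) + (⨆ i, x i)) / 2 ≤ z} / 2)

/-- Mechanism 2: `F₁` at the midpoint of the extreme locations of agents reporting
preference `F₁`, and likewise for `F₂`. -/
def mech2 {n : ℕ} (x : Loc n) (σ : Pref n) : ℝ × ℝ :=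
  ((sInf {z | ∃ i, σ i = true ∧ x i = z} + sSup {z | ∃ i, σ i = true ∧ x i = z}) / 2,
   (sInf {z | ∃ i, σ i = false ∧ x i = z} + sSup {z | ∃ i, σ i = false ∧ x i = z}) / 2)

/-- Mechanism 3: both facilities at `1/2`. -/
def mech3 : ℝ × ℝ := (1/2, 1/2)

/-- Mechanism 4: facilities at the two extreme reported locations. -/
def mech4 {n : ℕ} (x : Loc n) : ℝ × ℝ := (⨅ i, x i, ⨆ i, x i)

end

lemma cost_nonneg {α : ℝ} (hα : 1 ≤ α) (z : ℝ) (b : Bool) (y : ℝ × ℝ) : 0 ≤ cost α z b y :=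
  le_min (abs_nonneg _) (mul_nonneg (by linarith) (abs_nonneg _))

/-- The cost of an agent dominates its distance to one of the two facilities. -/
lemma abs_sub_le_cost {α : ℝ} (hα : 1 ≤ α) (z : ℝ) (b : Bool) (y : ℝ × ℝ) :
    |z - y.1| ≤ cost α z b y ∨ |z - y.2| ≤ cost α z b y := by
  have h (t : ℝ) : |t| ≤ α * |t| := le_mul_of_one_le_left (abs_nonneg t) hα
  rcases min_choice |z - facLoc y b| (α * |z - facLoc y (!b)|) with e | e <;>
    unfold cost <;> rw [e] <;> cases b <;> simp [facLoc, h]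

/-- Among three agents, two are served by a common facility. -/
lemma exists_sub_le_cost_add_cost {α : ℝ} (hα : 1 ≤ α) (l z h : ℝ) (a b c : Bool) (y : ℝ × ℝ) :
    z - l ≤ cost α l a y + cost α z b y ∨ h - z ≤ cost α z b y + cost α h c y ∨
      h - l ≤ cost α l a y + cost α h c y := by
  rcases abs_sub_le_cost hα l a y with h₁ | h₁ <;>
  rcases abs_sub_le_cost hα z b y with h₂ | h₂ <;>
  rcases abs_sub_le_cost hα h c y with h₃ | h₃ <;>
  rw [abs_le] at h₁ h₂ h₃ <;>
  first
  | exact .inl (by linarith)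
  | exact .inr (.inl (by linarith))
  | exact .inr (.inr (by linarith))

lemma cost_extremes_le {α : ℝ} (hα : 1 ≤ α) {l z h : ℝ} (hl : l ≤ z) (hh : z ≤ h) (b : Bool) :
    cost α z b (l, h) ≤ α * min (z - l) (h - z) := by
  have e₁ : |z - l| = z - l := abs_of_nonneg (by linarith)
  have e₂ : |z - h| = h - z := by rw [abs_sub_comm, abs_of_nonneg (by linarith)]
  have h₁ : z - l ≤ α * (z - l) := le_mul_of_one_le_left (by linarith) hα
  have h₂ : h - z ≤ α * (h - z) := le_mul_of_one_le_left (by linarith) hα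
  rw [mul_min_of_nonneg _ _ (by linarith)]
  cases b <;> simp only [cost, facLoc, Bool.not_false, Bool.not_true, Bool.false_eq_true, if_true,
    if_false, e₁, e₂]
  · exact (min_comm _ _).trans_le (min_le_min_left _ h₂)
  · exact min_le_min_right _ h₁

lemma cost_extremes_mono {α : ℝ} (hα : 1 ≤ α) {l l' z h h' : ℝ} (hl : l ≤ z) (hh : z ≤ h)
    (hl' : l' ≤ l) (hh' : h ≤ h') (b : Bool) : cost α z b (l, h) ≤ cost α z b (l', h') := by
  have h₁ : |z - l| ≤ |z - l'| := by
    rw [abs_of_nonneg (by linarith), abs_of_nonneg (by linarith)]; linarith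
  have h₂ : |z - h| ≤ |z - h'| := by
    rw [abs_of_nonpos (by linarith), abs_of_nonpos (by linarith)]; linarith
  have hα' : 0 ≤ α := by linarith
  cases b
  · exact min_le_min h₂ (mul_le_mul_of_nonneg_left h₁ hα')
  · exact min_le_min h₁ (mul_le_mul_of_nonneg_left h₂ hα')

section Extremes

variable {n : ℕ} {α : ℝ}

lemma cost_mech4_le (hα : 1 ≤ α) (x : Loc n) (b : Bool) (i : Fin n) :
    cost α (x i) b (mech4 x) ≤ α * min (x i - ⨅ j, x j) ((⨆ j, x j) - x i) :=
  cost_extremes_le hα (ciInf_le (Set.finite_range x).bddBelow i)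
    (le_ciSup (Set.finite_range x).bddAbove i) b

lemma cost_mech4_eq_zero (hα : 1 ≤ α) (x : Loc n) (b : Bool) {i : Fin n}
    (hi : x i = ⨅ j, x j ∨ x i = ⨆ j, x j) : cost α (x i) b (mech4 x) = 0 := by
  refine le_antisymm ((cost_mech4_le hα x b i).trans ?_) (cost_nonneg hα _ _ _)
  refine mul_nonpos_of_nonneg_of_nonpos (by linarith) (min_le_iff.2 ?_)
  exact hi.imp (fun h => by linarith) fun h => by linarith

variable [NeZero n]

lemma gspLocCost_mech4 (hα : 1 ≤ α) :
    GSPlocCost α (fun (x : Loc n) (_ : Pref n) => mech4 x) := by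
  intro x _ σ x' _ hne
  by_contra! H
  have fixed (i : Fin n) (hi : x i = ⨅ j, x j ∨ x i = ⨆ j, x j) : x' i = x i := by
    by_contra hx
    have := H i hx
    rw [cost_mech4_eq_zero hα x (σ i) hi] at this
    exact (cost_nonneg hα _ _ _).not_gt this
  obtain ⟨p, hp⟩ := exists_eq_ciInf_of_finite (f := x)
  obtain ⟨q, hq⟩ := exists_eq_ciSup_of_finite (f := x)
  obtain ⟨i, hi⟩ := Function.ne_iff.1 hne
  refine (H i hi).not_ge (cost_extremes_mono hα (ciInf_le (Set.finite_range x).bddBelow i)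
    (le_ciSup (Set.finite_range x).bddAbove i) ?_ ?_ (σ i))
  · rw [← hp, ← fixed p (.inl hp)]
    exact ciInf_le (Set.finite_range x').bddBelow p
  · rw [← hq, ← fixed q (.inr hq)]
    exact le_ciSup (Set.finite_range x').bddAbove q

lemma BC_mech4_le (hα : 1 ≤ α) (x : Loc n) (σ : Pref n) (y : ℝ × ℝ) :
    BC α x σ (mech4 x) ≤ 2 * α * BC α x σ y := by
  refine ciSup_le fun i => (cost_mech4_le hα x (σ i) i).trans ?_
  rw [mul_comm 2 α, mul_assoc]
  refine mul_le_mul_of_nonneg_left ?_ (by linarith)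
  obtain ⟨p, hp⟩ := exists_eq_ciInf_of_finite (f := x)
  obtain ⟨q, hq⟩ := exists_eq_ciSup_of_finite (f := x)
  have le_BC (j : Fin n) : cost α (x j) (σ j) y ≤ BC α x σ y :=
    le_ciSup (Set.finite_range fun j => cost α (x j) (σ j) y).bddAbove j
  have hpi : x p ≤ x i := hp ▸ ciInf_le (Set.finite_range x).bddBelow i
  have hiq : x i ≤ x q := hq ▸ le_ciSup (Set.finite_range x).bddAbove i
  rw [← hp, ← hq, min_le_iff]
  have := le_BC p
  have := le_BC q
  have := le_BC i
  rcases exists_sub_le_cost_add_cost hα (x p) (x i) (x q) (σ p) (σ i) (σ q) y with h | h | h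
  · exact .inl (by linarith)
  · exact .inr (by linarith)
  · exact .inl (by linarith)

lemma SC_mech4_le (hα : 1 ≤ α) (hn : 2 ≤ n) (x : Loc n) (σ : Pref n) (y : ℝ × ℝ) :
    SC α x σ (mech4 x) ≤ α * ((n : ℝ) - 2) * SC α x σ y := by
  obtain ⟨p, hp⟩ := exists_eq_ciInf_of_finite (f := x)
  obtain ⟨q, hq⟩ := exists_eq_ciSup_of_finite (f := x)
  have hpi (i : Fin n) : x p ≤ x i := hp ▸ ciInf_le (Set.finite_range x).bddBelow i
  have hiq (i : Fin n) : x i ≤ x q := hq ▸ le_ciSup (Set.finite_range x).bddAbove i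
  have cost_p := cost_mech4_eq_zero hα x (σ p) (.inl hp)
  have cost_q := cost_mech4_eq_zero hα x (σ q) (.inr hq)
  rcases eq_or_ne p q with rfl | hpq
  · have h₀ : SC α x σ (mech4 x) = 0 := Finset.sum_eq_zero fun i _ =>
      cost_mech4_eq_zero hα x (σ i) (.inl (by rw [← hp]; exact le_antisymm (hiq i) (hpi i)))
    rw [h₀]
    have hn' : (2 : ℝ) ≤ n := by exact_mod_cast hn
    exact mul_nonneg (mul_nonneg (by linarith) (by linarith))
      (Finset.sum_nonneg fun i _ => cost_nonneg hα _ _ _)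
  have key (i : Fin n) (hi : i ∉ ({p, q} : Finset (Fin n))) :
      cost α (x i) (σ i) (mech4 x) ≤ α * SC α x σ y := by
    simp only [Finset.mem_insert, Finset.mem_singleton, not_or] at hi
    refine (cost_mech4_le hα x (σ i) i).trans (mul_le_mul_of_nonneg_left ?_ (by linarith))
    have hsum : ∑ j ∈ {i, p, q}, cost α (x j) (σ j) y ≤ SC α x σ y :=
      Finset.sum_le_sum_of_subset_of_nonneg (Finset.subset_univ _)
        fun j _ _ => cost_nonneg hα _ _ _
    rw [Finset.sum_insert (by simpa using hi), Finset.sum_pair hpq] at hsum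
    have := cost_nonneg hα (x p) (σ p) y
    have := cost_nonneg hα (x q) (σ q) y
    have := cost_nonneg hα (x i) (σ i) y
    have := hpi i
    have := hiq i
    rw [← hp, ← hq, min_le_iff]
    rcases exists_sub_le_cost_add_cost hα (x p) (x i) (x q) (σ p) (σ i) (σ q) y with h | h | h
    · exact .inl (by linarith)
    · exact .inr (by linarith)
    · exact .inl (by linarith)
  have hcard : ((({p, q} : Finset (Fin n))ᶜ.card : ℕ) : ℝ) = (n : ℝ) - 2 := by
    rw [Finset.card_compl, Finset.card_pair hpq, Fintype.card_fin, Nat.cast_sub hn]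
    norm_num
  calc SC α x σ (mech4 x)
      = ∑ i ∈ ({p, q} : Finset (Fin n))ᶜ, cost α (x i) (σ i) (mech4 x) := by
        rw [SC, ← Finset.sum_add_sum_compl {p, q}, Finset.sum_pair hpq, cost_p, cost_q]
        ring
    _ ≤ ({p, q} : Finset (Fin n))ᶜ.card • (α * SC α x σ y) :=
        Finset.sum_le_card_nsmul _ _ _ fun i hi => key i (Finset.mem_compl.1 hi)
    _ = α * ((n : ℝ) - 2) * SC α x σ y := by
        rw [nsmul_eq_mul, hcard]
        ring

end Extremes

/-- A multiplicative bound against every feasible value holds against the infimum. -/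
lemma le_mul_sInf_inBox {a k : ℝ} (hk : 0 < k) (g : ℝ × ℝ → ℝ) (h : ∀ y, a ≤ k * g y) :
    a ≤ k * sInf {c | ∃ y, inBox y ∧ c = g y} := by
  rw [← div_le_iff₀' hk]
  refine le_csInf ⟨g (0, 0), (0, 0), by simp [inBox], rfl⟩ ?_
  rintro _ ⟨y, _, rfl⟩
  exact (div_le_iff₀' hk).2 (h y)

/-- Mechanism 4 (the two extreme reported locations) is group strategyproof with private
locations, `2α`-approximate under the maximum cost objective and `α(n−2)`-approximate
under the total cost objective. -/
theorem stmt_12 (α : ℝ) (hα : 1 ≤ α) (n : ℕ) (hn : 3 ≤ n) :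
    GSPlocCost α (fun (x : Loc n) (_ : Pref n) => mech4 x) ∧
    (∀ x : Loc n, validLoc x → ∀ σ : Pref n,
      BC α x σ (mech4 x) ≤ 2 * α * optBC α x σ) ∧
    (∀ x : Loc n, validLoc x → ∀ σ : Pref n,
      SC α x σ (mech4 x) ≤ α * ((n : ℝ) - 2) * optSC α x σ) := by
  have : NeZero n := ⟨by omega⟩
  have hn' : (3 : ℝ) ≤ n := by exact_mod_cast hn
  exact ⟨gspLocCost_mech4 hα,
    fun x _ σ => le_mul_sInf_inBox (by linarith) _ (BC_mech4_le hα x σ),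
    fun x _ σ => le_mul_sInf_inBox (mul_pos (by linarith) (by linarith)) _
      (SC_mech4_le hα (by omega) x σ)⟩
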